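/- arXiv:1910.10132 — 10 statements merged into one kernel-verified Lean document; each statement's English description precedes it below -/
import Mathlib

section
/- Let n ≥ 3 be an integer. Define the row-stochastic matrix P : Fin n → Fin n → ℝ by: P 0 0 = 5/6, P 0 1 = 1/6; P 1 0 = 5/6, P 1 2 = 1/6; for 2 ≤ i ≤ n-2, P i 0 = 2/3, P i (i-1) = 1/6 and P i (i+1) = 1/6; P (n-1) 0 = 5/6, P (n-1) (n-2) = 1/6; and P i j = 0 otherwise. Then the vector π : Fin n → ℝ defined by π i = 2*B(n-i) / b(n+1) (with the numbers cast to ℝ) is a steady-state vector of P, i.e., π j = ∑ i, π i * P i j for every j, and ∑ i, π i = 1. -/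
/-- Consecutive cobalancing numbers differ by twice a balancing number. -/
theorem cobalancing_succ_sub {B b : ℕ → ℤ} (hB0 : B 0 = 0) (hB1 : B 1 = 1)
    (hBrec : ∀ k, B (k + 2) = 6 * B (k + 1) - B k) (hb0 : b 0 = 0) (hb1 : b 1 = 0)
    (hbrec : ∀ k, b (k + 2) = 6 * b (k + 1) - b k + 2) (k : ℕ) :
    b (k + 1) - b k = 2 * B k := by
  induction k using Nat.twoStepInduction with
  | zero => simp [hB0, hb0, hb1]
  | one => simp [hB1, hb0, hb1, hbrec 0]
  | more k ih₁ ih₂ => linarith [hBrec k, hbrec k, hbrec (k + 1)]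

theorem two_mul_cobalancing {B b : ℕ → ℤ} (hB0 : B 0 = 0) (hB1 : B 1 = 1)
    (hBrec : ∀ k, B (k + 2) = 6 * B (k + 1) - B k) (hb0 : b 0 = 0) (hb1 : b 1 = 0)
    (hbrec : ∀ k, b (k + 2) = 6 * b (k + 1) - b k + 2) (k : ℕ) :
    2 * b (k + 2) = 5 * B (k + 1) - B k - 1 := by
  linarith [hbrec k, cobalancing_succ_sub hB0 hB1 hBrec hb0 hb1 hbrec k,
    cobalancing_succ_sub hB0 hB1 hBrec hb0 hb1 hbrec (k + 1)]

theorem two_mul_sum_balancing {B b : ℕ → ℤ} (hB0 : B 0 = 0) (hB1 : B 1 = 1)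
    (hBrec : ∀ k, B (k + 2) = 6 * B (k + 1) - B k) (hb0 : b 0 = 0) (hb1 : b 1 = 0)
    (hbrec : ∀ k, b (k + 2) = 6 * b (k + 1) - b k + 2) (n : ℕ) :
    2 * ∑ i ∈ Finset.range n, B (n - i) = b (n + 1) := by
  have hsum : ∑ i ∈ Finset.range n, B (n - i) = ∑ i ∈ Finset.range n, B (i + 1) := by
    rw [← Finset.sum_range_reflect (fun i => B (i + 1))]
    refine Finset.sum_congr rfl fun i hi => congrArg B ?_
    have := Finset.mem_range.mp hi
    omega
  rw [hsum, Finset.mul_sum,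
    ← Finset.sum_congr rfl fun i _ =>
      cobalancing_succ_sub hB0 hB1 hBrec hb0 hb1 hbrec (i + 1),
    Finset.sum_range_sub (fun i => b (i + 1)), hb1, sub_zero]

theorem cobalancing_pos {b : ℕ → ℤ} (hb0 : b 0 = 0) (hb1 : b 1 = 0)
    (hbrec : ∀ k, b (k + 2) = 6 * b (k + 1) - b k + 2) (k : ℕ) : 0 < b (k + 2) := by
  have hmono : ∀ k, 0 ≤ b k ∧ b k ≤ b (k + 1) := by
    intro k
    induction k with
    | zero => simp [hb0, hb1]
    | succ k ih => exact ⟨by linarith, by linarith [hbrec k]⟩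
  linarith [hbrec k, hmono k]

/-- The entries of the transition matrix, indexed by natural numbers. -/
noncomputable def balancingTransition (n i j : ℕ) : ℝ :=
  if i = 0 ∧ j = 0 then 5/6
  else if i = 0 ∧ j = 1 then 1/6
  else if i = 1 ∧ j = 0 then 5/6
  else if i = 1 ∧ j = 2 then 1/6
  else if 2 ≤ i ∧ i ≤ n - 2 ∧ j = 0 then 2/3
  else if 2 ≤ i ∧ i ≤ n - 2 ∧ j = i - 1 then 1/6
  else if 2 ≤ i ∧ i ≤ n - 2 ∧ j = i + 1 then 1/6
  else if i = n - 1 ∧ j = 0 then 5/6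
  else if i = n - 1 ∧ j = n - 2 then 1/6
  else 0

theorem balancingTransition_zero {n i : ℕ} (hn : 3 ≤ n) (hi : i < n) :
    balancingTransition n i 0 = 2 / 3 + (if i = 0 then 1 / 6 else 0)
      + (if i = 1 then 1 / 6 else 0) + (if i = n - 1 then 1 / 6 else 0) := by
  unfold balancingTransition
  grind (splits := 20)

theorem balancingTransition_succ {n i m : ℕ} (hn : 3 ≤ n) (hi : i < n) (hm : m + 1 < n) :
    balancingTransition n i (m + 1) = (if i = m then 1 / 6 else 0)
      + (if i = m + 2 then 1 / 6 else 0) := by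
  unfold balancingTransition
  grind (splits := 20)

/-- Balancing numbers in the steady state probabilities of the Markov chain (1). -/
theorem balancing_steady_state
    (n : ℕ) (hn : 3 ≤ n)
    (B : ℕ → ℤ) (hB0 : B 0 = 0) (hB1 : B 1 = 1)
    (hBrec : ∀ k, B (k + 2) = 6 * B (k + 1) - B k)
    (b : ℕ → ℤ) (hb0 : b 0 = 0) (hb1 : b 1 = 0)
    (hbrec : ∀ k, b (k + 2) = 6 * b (k + 1) - b k + 2)
    (P : Fin n → Fin n → ℝ)
    (hP : ∀ i j : Fin n, P i j =
      if i.val = 0 ∧ j.val = 0 then 5/6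
      else if i.val = 0 ∧ j.val = 1 then 1/6
      else if i.val = 1 ∧ j.val = 0 then 5/6
      else if i.val = 1 ∧ j.val = 2 then 1/6
      else if 2 ≤ i.val ∧ i.val ≤ n - 2 ∧ j.val = 0 then 2/3
      else if 2 ≤ i.val ∧ i.val ≤ n - 2 ∧ j.val = i.val - 1 then 1/6
      else if 2 ≤ i.val ∧ i.val ≤ n - 2 ∧ j.val = i.val + 1 then 1/6
      else if i.val = n - 1 ∧ j.val = 0 then 5/6
      else if i.val = n - 1 ∧ j.val = n - 2 then 1/6
      else 0)
    (π : Fin n → ℝ)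
    (hπ : ∀ i : Fin n, π i = 2 * (B (n - i.val) : ℝ) / (b (n + 1) : ℝ)) :
    (∀ j : Fin n, π j = ∑ i, π i * P i j) ∧ (∑ i, π i) = 1 := by
  have hbpos : (0 : ℝ) < b (n + 1) := by
    obtain ⟨k, rfl⟩ : ∃ k, n = k + 1 := ⟨n - 1, by omega⟩
    exact_mod_cast cobalancing_pos hb0 hb1 hbrec k
  have hsum : ∑ i, π i = 1 := by
    have h : 2 * ∑ i ∈ Finset.range n, (B (n - i) : ℝ) = b (n + 1) := by
      exact_mod_cast two_mul_sum_balancing hB0 hB1 hBrec hb0 hb1 hbrec n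
    simp_rw [hπ]
    rw [← Finset.sum_div, ← Finset.mul_sum,
      Fin.sum_univ_eq_sum_range (fun i => (B (n - i) : ℝ)), h, div_self hbpos.ne']
  refine ⟨fun j => ?_, hsum⟩
  by_cases hj : j.val = 0
  · have hcol : ∀ i : Fin n, P i j = 2 / 3 + (if i = ⟨0, by omega⟩ then 1 / 6 else 0)
        + (if i = ⟨1, by omega⟩ then 1 / 6 else 0)
        + (if i = ⟨n - 1, by omega⟩ then 1 / 6 else 0) := by
      intro i
      simp only [Fin.ext_iff]
      rw [← balancingTransition_zero hn i.isLt, ← hj]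
      exact hP i j
    simp_rw [hcol, mul_add, Finset.sum_add_distrib, ← Finset.sum_mul, hsum, mul_ite, mul_zero,
      Finset.sum_ite_eq', Finset.mem_univ, if_true, hπ]
    obtain ⟨k, rfl⟩ : ∃ k, n = k + 1 := ⟨n - 1, by omega⟩
    have h : (2 * b (k + 2) : ℝ) = 5 * B (k + 1) - B k - 1 := by
      exact_mod_cast two_mul_cobalancing hB0 hB1 hBrec hb0 hb1 hbrec k
    simp only [hj, Nat.sub_zero, Nat.add_sub_cancel, Nat.add_sub_cancel_left, hB1, Int.cast_one]
    field_simp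
    linarith
  · obtain ⟨m, hm⟩ : ∃ m, j.val = m + 1 := ⟨j.val - 1, by omega⟩
    have hjn := j.isLt
    have hcol : ∀ i : Fin n, P i j = (if i = ⟨m, by omega⟩ then 1 / 6 else 0)
        + (if i.val = m + 2 then 1 / 6 else 0) := by
      intro i
      simp only [Fin.ext_iff]
      rw [← balancingTransition_succ hn i.isLt (hm ▸ hjn), ← hm]
      exact hP i j
    have hnext : ∑ i : Fin n, (if i.val = m + 2 then π i * (1 / 6) else 0)
        = 2 * (B (n - (m + 2)) : ℝ) / b (n + 1) * (1 / 6) := by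
      simp_rw [hπ]
      rw [Fin.sum_univ_eq_sum_range (fun i => if i = m + 2 then
        2 * (B (n - i) : ℝ) / b (n + 1) * (1 / 6) else 0), Finset.sum_ite_eq']
      split_ifs with h
      · rfl
      · rw [Finset.mem_range, not_lt] at h
        simp [Nat.sub_eq_zero_of_le h, hB0]
    simp_rw [hcol, mul_add, Finset.sum_add_distrib, mul_ite, mul_zero, hnext,
      Finset.sum_ite_eq', Finset.mem_univ, if_true, hπ, hm]
    obtain ⟨k, rfl⟩ : ∃ k, n = k + (m + 2) := ⟨n - (m + 2), by omega⟩
    have h : (B (k + 2) : ℝ) = 6 * B (k + 1) - B k := by exact_mod_cast hBrec k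
    rw [show k + (m + 2) - (m + 1) = k + 1 by omega, show k + (m + 2) - m = k + 2 by omega,
      Nat.add_sub_cancel, h]
    ring
end

section
/- Let n ≥ 3 be an integer. Define the row-stochastic matrix P : Fin n → Fin n → ℝ by: P 0 0 = 5/6, P 0 1 = 1/6; P 1 0 = 5/6, P 1 2 = 1/6; for 2 ≤ i ≤ n-2, P i 0 = 2/3, P i (i-1) = 1/6, P i (i+1) = 1/6; P (n-1) 0 = 2/3, P (n-1) (n-2) = 1/6, P (n-1) (n-1) = 1/6; and P i j = 0 otherwise. Then the vector π : Fin n → ℝ defined by π i = (B(n-i) - B(n-i-1)) / B(n) (with the numbers cast to ℝ) is a steady-state vector of P, i.e., π j = ∑ i, π i * P i j for every j, and ∑ i, π i = 1. -/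
theorem balancing_nonneg_and_lt_succ {B : ℕ → ℤ} (hB0 : B 0 = 0) (hB1 : B 1 = 1)
    (hBrec : ∀ k, B (k + 2) = 6 * B (k + 1) - B k) (k : ℕ) :
    0 ≤ B k ∧ B k < B (k + 1) := by
  induction k with
  | zero => simp [hB0, hB1]
  | succ k ih =>
    have := hBrec k
    constructor <;> lia

theorem sum_range_reverse_sub (f : ℕ → ℝ) (n : ℕ) :
    ∑ i ∈ Finset.range n, (f (n - i) - f (n - i - 1)) = f n - f 0 := by
  rw [← Finset.sum_range_sub f n, ← Finset.sum_range_reflect (fun i => f (i + 1) - f i)]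
  refine Finset.sum_congr rfl fun i hi => ?_
  have hi := Finset.mem_range.1 hi
  rw [show n - 1 - i + 1 = n - i by lia, show n - 1 - i = n - i - 1 by lia]

theorem sum_fin_mul_ite_val_eq {n : ℕ} (f : ℕ → ℝ) (c : ℝ) {k : ℕ} (hk : k < n) :
    ∑ i : Fin n, f i * (if i.val = k then c else 0) = f k * c := by
  rw [Fin.sum_univ_eq_sum_range (fun i => f i * (if i = k then c else 0)) n]
  simp [hk]

/-- Differences of consecutive balancing numbers in the steady state probabilities of the
Markov chain (7). -/
theorem balancing_difference_steady_state
    (n : ℕ) (hn : 3 ≤ n)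
    (B : ℕ → ℤ) (hB0 : B 0 = 0) (hB1 : B 1 = 1)
    (hBrec : ∀ k, B (k + 2) = 6 * B (k + 1) - B k)
    (P : Fin n → Fin n → ℝ)
    (hP : ∀ i j : Fin n, P i j =
      if i.val = 0 ∧ j.val = 0 then 5/6
      else if i.val = 0 ∧ j.val = 1 then 1/6
      else if i.val = 1 ∧ j.val = 0 then 5/6
      else if i.val = 1 ∧ j.val = 2 then 1/6
      else if 2 ≤ i.val ∧ i.val ≤ n - 2 ∧ j.val = 0 then 2/3
      else if 2 ≤ i.val ∧ i.val ≤ n - 2 ∧ j.val = i.val - 1 then 1/6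
      else if 2 ≤ i.val ∧ i.val ≤ n - 2 ∧ j.val = i.val + 1 then 1/6
      else if i.val = n - 1 ∧ j.val = 0 then 2/3
      else if i.val = n - 1 ∧ j.val = n - 2 then 1/6
      else if i.val = n - 1 ∧ j.val = n - 1 then 1/6
      else 0)
    (π : Fin n → ℝ)
    (hπ : ∀ i : Fin n, π i = ((B (n - i.val) : ℝ) - (B (n - i.val - 1) : ℝ)) / (B n : ℝ)) :
    (∀ j : Fin n, π j = ∑ i, π i * P i j) ∧ (∑ i, π i) = 1 := by
  have hBn : (B n : ℝ) ≠ 0 := by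
    obtain ⟨m, rfl⟩ : ∃ m, n = m + 1 := ⟨n - 1, by lia⟩
    have := balancing_nonneg_and_lt_succ hB0 hB1 hBrec m
    exact_mod_cast (by lia : B (m + 1) ≠ 0)
  have hrec (k : ℕ) : (B (k + 2) : ℝ) = 6 * B (k + 1) - B k := by exact_mod_cast hBrec k
  set d : ℕ → ℝ := fun i => ((B (n - i) : ℝ) - (B (n - i - 1) : ℝ)) / (B n : ℝ) with hd
  have hπd : π = fun i : Fin n => d i.val := funext hπ
  have hsum : ∑ i : Fin n, d i.val = 1 := by
    rw [Fin.sum_univ_eq_sum_range d n, hd, ← Finset.sum_div,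
      sum_range_reverse_sub (fun k => (B k : ℝ)) n]
    simp [hB0, hBn]
  have hdrec (j : ℕ) (hj : j + 3 ≤ n) : 6 * d (j + 1) = d j + d (j + 2) := by
    obtain ⟨m, rfl⟩ := Nat.exists_eq_add_of_le' hj
    simp only [hd, show m + (j + 3) - j = m + 3 by lia, show m + 3 - 1 = m + 2 by lia,
      show m + (j + 3) - (j + 1) = m + 2 by lia, show m + 2 - 1 = m + 1 by lia,
      show m + (j + 3) - (j + 2) = m + 1 by lia, show m + 1 - 1 = m by lia]
    have h₁ := hrec m
    have h₂ := hrec (m + 1)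
    field_simp
    linarith
  subst hπd
  refine ⟨fun j => ?_, hsum⟩
  rcases Nat.eq_zero_or_pos j.val with hj | hj
  · have hcol (i : Fin n) : P i j = 2 / 3 + (if i.val = 0 then 1 / 6 else 0)
        + (if i.val = 1 then 1 / 6 else 0) := by
      rw [hP]
      clear hP hrec hdrec hBrec hsum
      grind (splits := 20)
    simp only [hcol, mul_add, Finset.sum_add_distrib, ← Finset.sum_mul, hsum, hj]
    rw [sum_fin_mul_ite_val_eq d _ (by lia), sum_fin_mul_ite_val_eq d _ (by lia)]
    obtain ⟨m, rfl⟩ := Nat.exists_eq_add_of_le' hn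
    simp only [hd, Nat.sub_zero, show m + 3 - 1 = m + 2 by lia, show m + 2 - 1 = m + 1 by lia]
    have h₂ := hrec (m + 1)
    field_simp
    linarith
  · obtain ⟨k, hk⟩ : ∃ k, j.val = k + 1 := ⟨j.val - 1, by lia⟩
    have hjn := j.isLt
    by_cases hlast : k + 2 = n
    · have hcol (i : Fin n) : P i j = (if i.val = k then 1 / 6 else 0)
          + (if i.val = k + 1 then 1 / 6 else 0) := by
        rw [hP]
        clear hP hrec hdrec hBrec hsum
        grind (splits := 20)
      simp only [hcol, mul_add, Finset.sum_add_distrib, hk]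
      rw [sum_fin_mul_ite_val_eq d _ (by lia), sum_fin_mul_ite_val_eq d _ (by lia)]
      subst hlast
      have h₀ := hrec 0
      simp only [hd, show k + 2 - (k + 1) = 1 by lia, show k + 2 - k = 2 by lia]
      simp only [zero_add, Nat.reduceSub, hB0, hB1] at h₀ ⊢
      rw [h₀]
      push_cast
      ring
    · have hcol (i : Fin n) : P i j = (if i.val = k then 1 / 6 else 0)
          + (if i.val = k + 2 then 1 / 6 else 0) := by
        rw [hP]
        clear hP hrec hdrec hBrec hsum
        grind (splits := 20)
      simp only [hcol, mul_add, Finset.sum_add_distrib, hk]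
      rw [sum_fin_mul_ite_val_eq d _ (by lia), sum_fin_mul_ite_val_eq d _ (by lia)]
      linarith [hdrec k (by lia)]
end

section
/- Let n ≥ 4 be an integer. Define the row-stochastic matrix P : Fin n → Fin n → ℝ by: P 0 0 = 5/6, P 0 1 = 1/6; P 1 0 = 5/6, P 1 2 = 1/6; for 2 ≤ i ≤ n-3, P i 0 = 2/3, P i (i-1) = 1/6, P i (i+1) = 1/6; P (n-2) 0 = 16/21, P (n-2) (n-3) = 1/6, P (n-2) (n-1) = 1/14; P (n-1) 0 = 1/3, P (n-1) (n-2) = 1/6, P (n-1) (n-1) = 1/2; and P i j = 0 otherwise. Then the vector π : Fin n → ℝ defined by π i = c(n-1-i) / (∑_{l=0}^{n-1} c(l)) (with the numbers cast to ℝ) is a steady-state vector of P, i.e., π j = ∑ i, π i * P i j for every j, and ∑ i, π i = 1. -/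
theorem Fintype.sum_eq_add_three {ι M : Type*} [Fintype ι] [DecidableEq ι] [AddCommMonoid M]
    {f : ι → M} (a b c : ι) (hab : a ≠ b) (hac : a ≠ c) (hbc : b ≠ c)
    (h : ∀ x, x ≠ a → x ≠ b → x ≠ c → f x = 0) : ∑ x, f x = f a + f b + f c := by
  rw [← Finset.sum_subset (Finset.subset_univ {a, b, c})]
  · rw [Finset.sum_insert (by simp [hab, hac]), Finset.sum_pair hbc, add_assoc]
  · intro x _ hx
    simp only [Finset.mem_insert, Finset.mem_singleton, not_or] at hx
    exact h x hx.1 hx.2.1 hx.2.2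

theorem lucas_cobalancing_pos {c : ℕ → ℤ} (hc0 : c 0 = 1) (hc1 : c 1 = 7)
    (hcrec : ∀ k, c (k + 2) = 6 * c (k + 1) - c k) (k : ℕ) : 0 < c k := by
  suffices h : 0 < c k ∧ c k < c (k + 1) from h.1
  induction k with
  | zero => simp [hc0, hc1]
  | succ k ih =>
    have := hcrec k
    constructor <;> lia

/-- For a matrix with unit row sums, all balance equations but one imply the remaining one. -/
theorem balance_of_forall_ne {ι R : Type*} [Fintype ι] [DecidableEq ι] [CommRing R]
    {P : ι → ι → R} (hrow : ∀ i, ∑ j, P i j = 1) (v : ι → R) (a : ι)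
    (h : ∀ j, j ≠ a → v j = ∑ i, v i * P i j) (j : ι) : v j = ∑ i, v i * P i j := by
  by_cases hj : j = a
  · subst hj
    have htot : ∑ k, ∑ i, v i * P i k = ∑ i, v i := by
      rw [Finset.sum_comm]
      simp [← Finset.mul_sum, hrow]
    rw [← Finset.add_sum_erase _ _ (Finset.mem_univ j),
      ← Finset.add_sum_erase _ v (Finset.mem_univ j),
      Finset.sum_congr rfl fun k hk => (h k (Finset.ne_of_mem_erase hk)).symm] at htot
    exact (add_right_cancel htot).symm
  · exact h j hj

/-- Lucas-cobalancing numbers in the steady state probabilities of the Markov chain (10). -/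
theorem lucas_cobalancing_steady_state
    (n : ℕ) (hn : 4 ≤ n)
    (c : ℕ → ℤ) (hc0 : c 0 = 1) (hc1 : c 1 = 7)
    (hcrec : ∀ k, c (k + 2) = 6 * c (k + 1) - c k)
    (P : Fin n → Fin n → ℝ)
    (hP : ∀ i j : Fin n, P i j =
      if i.val = 0 ∧ j.val = 0 then 5/6
      else if i.val = 0 ∧ j.val = 1 then 1/6
      else if i.val = 1 ∧ j.val = 0 then 5/6
      else if i.val = 1 ∧ j.val = 2 then 1/6
      else if 2 ≤ i.val ∧ i.val ≤ n - 3 ∧ j.val = 0 then 2/3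
      else if 2 ≤ i.val ∧ i.val ≤ n - 3 ∧ j.val = i.val - 1 then 1/6
      else if 2 ≤ i.val ∧ i.val ≤ n - 3 ∧ j.val = i.val + 1 then 1/6
      else if i.val = n - 2 ∧ j.val = 0 then 16/21
      else if i.val = n - 2 ∧ j.val = n - 3 then 1/6
      else if i.val = n - 2 ∧ j.val = n - 1 then 1/14
      else if i.val = n - 1 ∧ j.val = 0 then 1/3
      else if i.val = n - 1 ∧ j.val = n - 2 then 1/6
      else if i.val = n - 1 ∧ j.val = n - 1 then 1/2
      else 0)
    (π : Fin n → ℝ)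
    (hπ : ∀ i : Fin n,
      π i = (c (n - 1 - i.val) : ℝ) / ((∑ l ∈ Finset.range n, c l : ℤ) : ℝ)) :
    (∀ j : Fin n, π j = ∑ i, π i * P i j) ∧ (∑ i, π i) = 1 := by
  have hcpos := lucas_cobalancing_pos hc0 hc1 hcrec
  have hS : ((∑ l ∈ Finset.range n, c l : ℤ) : ℝ) ≠ 0 := by
    have : 0 < ∑ l ∈ Finset.range n, c l :=
      Finset.sum_pos (fun l _ => hcpos l) (Finset.nonempty_range_iff.mpr (by lia))
    exact_mod_cast this.ne'
  have hrow : ∀ i, ∑ j, P i j = 1 := by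
    rintro ⟨i, hi⟩
    by_cases h0 : i = 0
    · rw [Fintype.sum_eq_add (⟨0, by lia⟩ : Fin n) ⟨1, by lia⟩ (by simp)
        (by rintro ⟨k, hk⟩ ⟨h1, h2⟩; simp only [ne_eq, Fin.mk.injEq] at h1 h2; grind)]
      grind
    by_cases h1 : i = 1
    · rw [Fintype.sum_eq_add (⟨0, by lia⟩ : Fin n) ⟨2, by lia⟩ (by simp)
        (by rintro ⟨k, hk⟩ ⟨h1, h2⟩; simp only [ne_eq, Fin.mk.injEq] at h1 h2; grind)]
      grind
    by_cases hl : i = n - 1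
    · rw [Fintype.sum_eq_add_three (⟨0, by lia⟩ : Fin n) ⟨n - 2, by lia⟩ ⟨n - 1, by lia⟩
        (by simp; lia) (by simp; lia) (by simp; lia)
        (by rintro ⟨k, hk⟩ h1 h2 h3; simp only [ne_eq, Fin.mk.injEq] at h1 h2 h3; grind)]
      grind
    · rw [Fintype.sum_eq_add_three (⟨0, by lia⟩ : Fin n) ⟨i - 1, by lia⟩ ⟨i + 1, by lia⟩
        (by simp; lia) (by simp) (by simp)
        (by rintro ⟨k, hk⟩ h1 h2 h3; simp only [ne_eq, Fin.mk.injEq] at h1 h2 h3; grind)]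
      grind
  constructor
  · refine balance_of_forall_ne hrow π ⟨0, by lia⟩ ?_
    rintro ⟨j, hj⟩ hj0
    simp only [ne_eq, Fin.mk.injEq] at hj0
    by_cases hl : j = n - 1
    · rw [Fintype.sum_eq_add (⟨n - 2, by lia⟩ : Fin n) ⟨n - 1, by lia⟩ (by simp; lia)
        (by rintro ⟨k, hk⟩ ⟨h1, h2⟩; simp only [ne_eq, Fin.mk.injEq] at h1 h2; grind)]
      have e1 : P ⟨n - 2, by lia⟩ ⟨j, hj⟩ = 1 / 14 := by grind
      have e2 : P ⟨n - 1, by lia⟩ ⟨j, hj⟩ = 1 / 2 := by grind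
      rw [e1, e2, hπ, hπ, hπ]
      simp only [hl, show n - 1 - (n - 1) = 0 by lia, show n - 1 - (n - 2) = 1 by lia, hc0, hc1]
      push_cast
      ring
    · rw [Fintype.sum_eq_add (⟨j - 1, by lia⟩ : Fin n) ⟨j + 1, by lia⟩ (by simp)
        (by rintro ⟨k, hk⟩ ⟨h1, h2⟩; simp only [ne_eq, Fin.mk.injEq] at h1 h2; grind)]
      have e1 : P ⟨j - 1, by lia⟩ ⟨j, hj⟩ = 1 / 6 := by grind
      have e2 : P ⟨j + 1, by lia⟩ ⟨j, hj⟩ = 1 / 6 := by grind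
      rw [e1, e2, hπ, hπ, hπ]
      obtain ⟨m, rfl⟩ : ∃ m, n = m + j + 2 := ⟨n - j - 2, by lia⟩
      simp only [show m + j + 2 - 1 - j = m + 1 by lia,
        show m + j + 2 - 1 - (j - 1) = m + 2 by lia,
        show m + j + 2 - 1 - (j + 1) = m by lia, hcrec]
      push_cast
      ring
  · simp only [hπ]
    rw [← Finset.sum_div, Fin.sum_univ_eq_sum_range (fun i => (c (n - 1 - i) : ℝ)) n,
      Finset.sum_range_reflect (fun i => (c i : ℝ)) n, ← Int.cast_sum, div_self hS]
end

section
/- Define the infinite transition matrix P : ℕ → ℕ → ℝ by: P 0 0 = 5/6, P 0 1 = 1/6; P 1 0 = 5/6, P 1 2 = 1/6; for i ≥ 2, P i 0 = 2/3, P i (i-1) = 1/6, P i (i+1) = 1/6; and P i j = 0 otherwise. Let β = 3 - 2*√2 and define π : ℕ → ℝ by π i = β^i - β^(i+1). Then for every j, π j = ∑' i, π i * P i j (the series converging), and ∑' i, π i = 1. -/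
/-- The silver-ratio steady state probabilities of the infinite-state Markov chain (11). -/
theorem silver_ratio_steady_state
    (P : ℕ → ℕ → ℝ)
    (hP : ∀ i j : ℕ, P i j =
      if i = 0 ∧ j = 0 then 5/6
      else if i = 0 ∧ j = 1 then 1/6
      else if i = 1 ∧ j = 0 then 5/6
      else if i = 1 ∧ j = 2 then 1/6
      else if 2 ≤ i ∧ j = 0 then 2/3
      else if 2 ≤ i ∧ j = i - 1 then 1/6
      else if 2 ≤ i ∧ j = i + 1 then 1/6
      else 0)
    (β : ℝ) (hβ : β = 3 - 2 * Real.sqrt 2)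
    (π : ℕ → ℝ) (hπ : ∀ i : ℕ, π i = β ^ i - β ^ (i + 1)) :
    (∀ j : ℕ, Summable (fun i => π i * P i j) ∧ π j = ∑' i, π i * P i j) ∧
      (∑' i, π i) = 1 := by
  have hsq : β ^ 2 = 6 * β - 1 := by
    rw [hβ]
    linear_combination 4 * Real.sq_sqrt (show (0 : ℝ) ≤ 2 by norm_num)
  have hβ0 : 0 ≤ β := by
    rw [hβ]
    nlinarith [Real.sq_sqrt (show (0 : ℝ) ≤ 2 by norm_num), Real.sqrt_nonneg 2]
  have hβ1 : β < 1 := by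
    rw [hβ]
    nlinarith [Real.sq_sqrt (show (0 : ℝ) ≤ 2 by norm_num), Real.sqrt_nonneg 2]
  have hsum : HasSum π 1 := by
    have hgeom : π = fun i => (1 - β) * β ^ i := funext fun i => by rw [hπ]; ring
    have h := (hasSum_geometric_of_lt_one hβ0 hβ1).mul_left (1 - β)
    rwa [mul_inv_cancel₀ (by linarith), ← hgeom] at h
  refine ⟨fun j => ?_, hsum.tsum_eq⟩
  suffices h : HasSum (fun i => π i * P i j) (π j) from ⟨h.summable, h.tsum_eq.symm⟩
  cases j with
  | zero =>
    have hcol : ∀ i, P i 0 = 2 / 3 + if i < 2 then 1 / 6 else 0 := by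
      intro i
      rw [hP]
      rcases i with _ | _ | i <;> norm_num
    have hfin : HasSum (fun i => π i * if i < 2 then 1 / 6 else 0)
        (∑ i ∈ Finset.range 2, π i * if i < 2 then 1 / 6 else 0) :=
      hasSum_sum_of_ne_finset_zero fun i hi => by
        rw [if_neg (by simpa using hi), mul_zero]
    have hval : π 0 = 1 * (2 / 3) + ∑ i ∈ Finset.range 2, π i * if i < 2 then 1 / 6 else 0 := by
      norm_num [Finset.sum_range_succ, hπ]
      linear_combination hsq / 6
    simp_rw [hcol, mul_add]
    rw [hval]
    exact (hsum.mul_right (2 / 3)).add hfin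
  | succ k =>
    have hcol : ∀ i, P i (k + 1) = if i = k ∨ i = k + 2 then 1 / 6 else 0 := by
      intro i
      rw [hP]
      simp only [Nat.succ_ne_zero, and_false, if_false]
      split_ifs <;> first | rfl | omega
    have hfin : HasSum (fun i => π i * P i (k + 1))
        (∑ i ∈ {k, k + 2}, π i * P i (k + 1)) :=
      hasSum_sum_of_ne_finset_zero fun i hi => by
        rw [hcol, if_neg (by simpa using hi), mul_zero]
    convert hfin using 1
    rw [Finset.sum_pair (by omega), hcol, hcol, if_pos (Or.inl rfl), if_pos (Or.inr rfl),
      hπ, hπ, hπ]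
    linear_combination (-(β ^ k * (1 - β)) / 6) * hsq
end

section
/- Let q be a real number with 0 < q ≤ 1/6. Define the infinite transition matrix P(q) : ℕ → ℕ → ℝ by: P 0 0 = 1-q, P 0 1 = q; P 1 0 = 5q, P 1 1 = 1-6q, P 1 2 = q; for i ≥ 2, P i 0 = 4q, P i (i-1) = q, P i i = 1-6q, P i (i+1) = q; and P i j = 0 otherwise. Let β = 3 - 2*√2 and define π : ℕ → ℝ by π i = β^i - β^(i+1). Then for every j, π j = ∑' i, π i * P(q) i j (the series converging), and ∑' i, π i = 1. -/
theorem hasSum_pow_sub_pow_succ {β : ℝ} (h0 : 0 ≤ β) (h1 : β < 1) :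
    HasSum (fun i : ℕ => β ^ i - β ^ (i + 1)) 1 := by
  have h := (hasSum_geometric_of_lt_one h0 h1).mul_right (1 - β)
  rw [inv_mul_cancel₀ (by linarith)] at h
  have hfun : (fun i : ℕ => β ^ i - β ^ (i + 1)) = fun i => β ^ i * (1 - β) := by
    funext i
    ring
  rwa [hfun]

/-- The silver-ratio steady state probabilities of the infinite-state class of Markov
chains (13). -/
theorem silver_ratio_steady_state_class
    (q : ℝ) (hq0 : 0 < q) (hq1 : q ≤ 1/6)
    (P : ℕ → ℕ → ℝ)
    (hP : ∀ i j : ℕ, P i j =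
      if i = 0 ∧ j = 0 then 1 - q
      else if i = 0 ∧ j = 1 then q
      else if i = 1 ∧ j = 0 then 5 * q
      else if i = 1 ∧ j = 1 then 1 - 6 * q
      else if i = 1 ∧ j = 2 then q
      else if 2 ≤ i ∧ j = 0 then 4 * q
      else if 2 ≤ i ∧ j = i - 1 then q
      else if 2 ≤ i ∧ j = i then 1 - 6 * q
      else if 2 ≤ i ∧ j = i + 1 then q
      else 0)
    (β : ℝ) (hβ : β = 3 - 2 * Real.sqrt 2)
    (π : ℕ → ℝ) (hπ : ∀ i : ℕ, π i = β ^ i - β ^ (i + 1)) :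
    (∀ j : ℕ, Summable (fun i => π i * P i j) ∧ π j = ∑' i, π i * P i j) ∧
      (∑' i, π i) = 1 := by
  have hsq : Real.sqrt 2 ^ 2 = 2 := Real.sq_sqrt (by norm_num)
  have hs0 : 0 ≤ Real.sqrt 2 := Real.sqrt_nonneg 2
  have hβ2 : β ^ 2 = 6 * β - 1 := by rw [hβ]; linear_combination 4 * hsq
  have h0 : 0 ≤ β := by rw [hβ]; nlinarith
  have h1 : β < 1 := by rw [hβ]; nlinarith
  have hsum : HasSum π 1 := by
    rw [funext hπ]
    exact hasSum_pow_sub_pow_succ h0 h1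
  suffices h : ∀ j, HasSum (fun i => π i * P i j) (π j) from
    ⟨fun j => ⟨(h j).summable, (h j).tsum_eq.symm⟩, hsum.tsum_eq⟩
  rintro (_ | k)
  · rw [← hasSum_nat_add_iff' 2]
    have htail := ((hasSum_nat_add_iff' 2).mpr hsum).mul_right (4 * q)
    have hfun : (fun i => π (i + 2) * P (i + 2) 0) = fun i => π (i + 2) * (4 * q) := by
      funext i
      simp [hP]
    have hval : π 0 - ∑ i ∈ Finset.range 2, π i * P i 0 =
        (1 - ∑ i ∈ Finset.range 2, π i) * (4 * q) := by
      simp only [Finset.sum_range_succ, Finset.sum_range_zero, hP, hπ]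
      norm_num
      linear_combination q * hβ2
    rw [hval]
    exact hfun ▸ htail
  · have hfin : HasSum (fun i => π i * P i (k + 1))
        (∑ i ∈ Finset.Ico k (k + 3), π i * P i (k + 1)) := by
      apply hasSum_sum_of_ne_finset_zero
      intro i hi
      rw [Finset.mem_Ico] at hi
      have hz : P i (k + 1) = 0 := by
        grind
      rw [hz, mul_zero]
    have hbelow : P k (k + 1) = q := by
      grind
    have hdiag : P (k + 1) (k + 1) = 1 - 6 * q := by
      grind
    have habove : P (k + 2) (k + 1) = q := by
      grind
    convert hfin using 1
    rw [Finset.sum_Ico_eq_sum_range, show k + 3 - k = 3 by omega]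
    simp only [Finset.sum_range_succ, Finset.sum_range_zero, add_zero, hbelow, hdiag, habove, hπ]
    linear_combination -q * β ^ k * (1 - β) * hβ2
end

section
/- Let A ≥ 3 be an integer, let x : ℕ → ℤ be the balancing-like sequence given by x 0 = 0, x 1 = 1, x (k+2) = A*x (k+1) - x k, and let q be a real number with 0 < q ≤ 1/A. Let n ≥ 3 be an integer. Define the row-stochastic matrix P(q) : Fin n → Fin n → ℝ by: P 0 0 = 1-q, P 0 1 = q; P 1 0 = (A-1)q, P 1 1 = 1-Aq, P 1 2 = q; for 2 ≤ i ≤ n-2, P i 0 = (A-2)q, P i (i-1) = q, P i i = 1-Aq, P i (i+1) = q; P (n-1) 0 = (A-1)q, P (n-1) (n-2) = q, P (n-1) (n-1) = 1-Aq; and P i j = 0 otherwise. Then the vector π : Fin n → ℝ defined by π i = x(n-i) / (∑_{l=1}^{n} x(l)) (with the numbers cast to ℝ) is a steady-state vector of P(q), i.e., π j = ∑ i, π i * P(q) i j for every j, and ∑ i, π i = 1. -/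
theorem balancing_like_nonneg_lt_succ {A : ℤ} (hA : 3 ≤ A) {x : ℕ → ℤ} (hx0 : x 0 = 0)
    (hx1 : x 1 = 1) (hxrec : ∀ k, x (k + 2) = A * x (k + 1) - x k) (k : ℕ) :
    0 ≤ x k ∧ x k < x (k + 1) := by
  induction k with
  | zero => simp [hx0, hx1]
  | succ k ih =>
    refine ⟨by linarith, ?_⟩
    rw [hxrec k]
    nlinarith

theorem balancing_like_sum_Icc {A : ℤ} {x : ℕ → ℤ} (hx0 : x 0 = 0) (hx1 : x 1 = 1)
    (hxrec : ∀ k, x (k + 2) = A * x (k + 1) - x k) (n : ℕ) :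
    (A - 2) * ∑ l ∈ Finset.Icc 1 n, x l = x (n + 1) - x n - 1 := by
  induction n with
  | zero => simp [hx0, hx1]
  | succ n ih =>
    rw [Finset.sum_Icc_succ_top (by omega), mul_add, ih, hxrec n]
    ring

theorem sum_range_sub_eq_sum_Icc {M : Type*} [AddCommMonoid M] (f : ℕ → M) (n : ℕ) :
    ∑ i ∈ Finset.range n, f (n - i) = ∑ l ∈ Finset.Icc 1 n, f l := by
  refine Finset.sum_nbij' (fun i => n - i) (fun l => n - l) ?_ ?_ ?_ ?_ ?_ <;>
    simp only [Finset.mem_range, Finset.mem_Icc] <;> intros <;> first | omega | trivial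


/-- Balancing-like numbers in the steady state probabilities of the class of Markov
chains at the end of Section 5. -/
theorem balancing_like_steady_state_class
    (A : ℤ) (hA : 3 ≤ A)
    (x : ℕ → ℤ) (hx0 : x 0 = 0) (hx1 : x 1 = 1)
    (hxrec : ∀ k, x (k + 2) = A * x (k + 1) - x k)
    (q : ℝ) (hq0 : 0 < q) (hq1 : q ≤ 1 / (A : ℝ))
    (n : ℕ) (hn : 3 ≤ n)
    (P : Fin n → Fin n → ℝ)
    (hP : ∀ i j : Fin n, P i j =
      if i.val = 0 ∧ j.val = 0 then 1 - q
      else if i.val = 0 ∧ j.val = 1 then q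
      else if i.val = 1 ∧ j.val = 0 then ((A : ℝ) - 1) * q
      else if i.val = 1 ∧ j.val = 1 then 1 - (A : ℝ) * q
      else if i.val = 1 ∧ j.val = 2 then q
      else if 2 ≤ i.val ∧ i.val ≤ n - 2 ∧ j.val = 0 then ((A : ℝ) - 2) * q
      else if 2 ≤ i.val ∧ i.val ≤ n - 2 ∧ j.val = i.val - 1 then q
      else if 2 ≤ i.val ∧ i.val ≤ n - 2 ∧ j.val = i.val then 1 - (A : ℝ) * q
      else if 2 ≤ i.val ∧ i.val ≤ n - 2 ∧ j.val = i.val + 1 then q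
      else if i.val = n - 1 ∧ j.val = 0 then ((A : ℝ) - 1) * q
      else if i.val = n - 1 ∧ j.val = n - 2 then q
      else if i.val = n - 1 ∧ j.val = n - 1 then 1 - (A : ℝ) * q
      else 0)
    (π : Fin n → ℝ)
    (hπ : ∀ i : Fin n, π i = (x (n - i.val) : ℝ) / ((∑ l ∈ Finset.Icc 1 n, x l : ℤ) : ℝ)) :
    (∀ j : Fin n, π j = ∑ i, π i * P i j) ∧ (∑ i, π i) = 1 := by
  set S : ℤ := ∑ l ∈ Finset.Icc 1 n, x l with hS
  have hpos : ∀ k, 0 < x (k + 1) := fun k =>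
    let h := balancing_like_nonneg_lt_succ hA hx0 hx1 hxrec k
    h.1.trans_lt h.2
  have hSpos : 0 < S := by
    refine Finset.sum_pos (fun l hl => ?_) ⟨1, by simp; omega⟩
    obtain ⟨k, rfl⟩ := Nat.exists_eq_add_of_le' (Finset.mem_Icc.1 hl).1
    exact hpos k
  have hS0 : (S : ℝ) ≠ 0 := by exact_mod_cast hSpos.ne'
  have hsum : ∑ i ∈ Finset.range n, (x (n - i) : ℝ) = S := by
    rw [sum_range_sub_eq_sum_Icc (fun l => (x l : ℝ)), hS]
    push_cast
    rfl
  have hrec : ∀ k, (x (k + 2) : ℝ) = A * x (k + 1) - x k := fun k => by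
    exact_mod_cast hxrec k
  refine ⟨fun j => ?_, ?_⟩
  · suffices h : ∑ i : Fin n, (x (n - i.val) : ℝ) * P i j = x (n - j.val) by
      simp_rw [hπ, div_mul_eq_mul_div]
      rw [← Finset.sum_div, h]
    by_cases hj : j.val = 0
    · have hcol : ∀ i : Fin n, P i j = (A - 2) * q + (if i.val = 0 then 1 - q - (A - 2) * q else 0)
          + (if i.val = 1 then q else 0) + (if i.val = n - 1 then q else 0) := by
        intro i
        have := i.isLt
        rw [hP]
        grind
      rw [Finset.sum_congr rfl fun i _ => by rw [hcol i]]
      rw [Fin.sum_univ_eq_sum_range (fun i => (x (n - i) : ℝ) * ((A - 2) * q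
        + (if i = 0 then 1 - q - (A - 2) * q else 0)
        + (if i = 1 then q else 0) + (if i = n - 1 then q else 0)))]
      simp only [mul_add, Finset.sum_add_distrib, mul_ite, mul_zero, Finset.sum_ite_eq',
        Finset.mem_range, ← Finset.sum_mul, hsum]
      rw [if_pos (by omega), if_pos (by omega), if_pos (by omega), hj,
        show n - (n - 1) = 1 by omega, hx1]
      obtain ⟨m, rfl⟩ := Nat.exists_eq_add_of_le' (show 1 ≤ n by omega)
      have hclosed : ((A : ℝ) - 2) * S = x (m + 2) - x (m + 1) - 1 := by
        exact_mod_cast balancing_like_sum_Icc hx0 hx1 hxrec (m + 1)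
      rw [hrec m] at hclosed
      simp only [Nat.add_sub_cancel, Nat.sub_zero]
      push_cast
      linear_combination q * hclosed
    · have hcol : ∀ i : Fin n, P i j = (if i.val = j.val then 1 - A * q else 0)
          + (if i.val = j.val - 1 then q else 0) + (if i.val = j.val + 1 then q else 0) := by
        intro i
        have := i.isLt
        have := j.isLt
        rw [hP]
        clear hx0 hx1 hxrec hpos hrec hsum hπ hP
        grind (splits := 30)
      rw [Finset.sum_congr rfl fun i _ => by rw [hcol i]]
      rw [Fin.sum_univ_eq_sum_range (fun i => (x (n - i) : ℝ) * (
        (if i = j.val then 1 - A * q else 0)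
        + (if i = j.val - 1 then q else 0) + (if i = j.val + 1 then q else 0)))]
      have hjn := j.isLt
      have hlast : (if j.val + 1 < n then (x (n - (j.val + 1)) : ℝ) * q else 0)
          = x (n - (j.val + 1)) * q := by
        split_ifs with h
        · rfl
        · rw [show n - (j.val + 1) = 0 by omega, hx0]
          simp
      simp only [mul_add, Finset.sum_add_distrib, mul_ite, mul_zero, Finset.sum_ite_eq',
        Finset.mem_range]
      rw [if_pos hjn, if_pos (by omega), hlast]
      have h := hrec (n - (j.val + 1))
      rw [show n - (j.val + 1) + 2 = n - (j.val - 1) by omega,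
        show n - (j.val + 1) + 1 = n - j.val by omega] at h
      linear_combination q * h
  · simp_rw [hπ]
    rw [← Finset.sum_div, Fin.sum_univ_eq_sum_range (fun i => (x (n - i) : ℝ)), hsum,
      div_self hS0]
end

section
/- Suppose π : ℕ → ℝ satisfies π 1 = 5*π 0 - 4 and π (i+1) = 6*π i - π (i-1) for all i ≥ 1. Then for every i ≥ 1, π i = (B(i+1) - B(i)) * π 0 - 4*B(i), where the balancing numbers are cast to ℝ. -/
/-- Equation (12): the solution of the balance equations of the infinite chain in terms
of balancing numbers. -/
theorem balance_equations_solution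
    (B : ℕ → ℤ) (hB0 : B 0 = 0) (hB1 : B 1 = 1)
    (hBrec : ∀ k, B (k + 2) = 6 * B (k + 1) - B k)
    (π : ℕ → ℝ)
    (hπ1 : π 1 = 5 * π 0 - 4)
    (hπrec : ∀ i : ℕ, 1 ≤ i → π (i + 1) = 6 * π i - π (i - 1)) :
    ∀ i : ℕ, 1 ≤ i → π i = ((B (i + 1) : ℝ) - (B i : ℝ)) * π 0 - 4 * (B i : ℝ) := by
  have hB (k : ℕ) : (B (k + 2) : ℝ) = 6 * B (k + 1) - B k := mod_cast hBrec k
  suffices h : ∀ i, π i = ((B (i + 1) : ℝ) - (B i : ℝ)) * π 0 - 4 * (B i : ℝ) from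
    fun i _ => h i
  intro i
  induction i using Nat.twoStepInduction with
  | zero => simp [hB0, hB1]
  | one =>
    rw [hπ1, hB 0]
    norm_num [hB0, hB1]
  | more n ih₀ ih₁ =>
    have hπ : π (n + 2) = 6 * π (n + 1) - π n := hπrec (n + 1) n.succ_pos
    rw [hπ, ih₀, ih₁, hB (n + 1), hB n]
    ring
end

section
/- For every natural number n, 2 * (∑_{l=1}^{n} B(l)) = b(n+1), i.e., the sum of the first n balancing numbers equals half of the (n+1)-st cobalancing number. -/
/-- Consecutive cobalancing numbers differ by twice a balancing number. -/
theorem cobalancing_succ_eq_add_two_mul_balancing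
    (B : ℕ → ℤ) (hB0 : B 0 = 0) (hB1 : B 1 = 1)
    (hBrec : ∀ k, B (k + 2) = 6 * B (k + 1) - B k)
    (b : ℕ → ℤ) (hb0 : b 0 = 0) (hb1 : b 1 = 0)
    (hbrec : ∀ k, b (k + 2) = 6 * b (k + 1) - b k + 2) (n : ℕ) :
    b (n + 1) = b n + 2 * B n := by
  induction n using Nat.twoStepInduction with
  | zero => simp [hb0, hb1, hB0]
  | one => simp [hbrec 0, hb0, hb1, hB1]
  | more n ih₀ ih₁ => linarith [hbrec n, hbrec (n + 1), hBrec n]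

/-- The sum of the first n balancing numbers is half of the (n+1)-st cobalancing number. -/
theorem sum_balancing_eq_half_cobalancing
    (B : ℕ → ℤ) (hB0 : B 0 = 0) (hB1 : B 1 = 1)
    (hBrec : ∀ k, B (k + 2) = 6 * B (k + 1) - B k)
    (b : ℕ → ℤ) (hb0 : b 0 = 0) (hb1 : b 1 = 0)
    (hbrec : ∀ k, b (k + 2) = 6 * b (k + 1) - b k + 2) :
    ∀ n : ℕ, 2 * (∑ l ∈ Finset.Icc 1 n, B l) = b (n + 1) := by
  intro n
  induction n with
  | zero => simp [hb1]
  | succ n ih =>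
    rw [Finset.sum_Icc_succ_top (by lia), mul_add, ih,
      cobalancing_succ_eq_add_two_mul_balancing B hB0 hB1 hBrec b hb0 hb1 hbrec (n + 1)]
end

section
/- For every natural number n, P(2n) = 2*B(n) and P(2n+1) = B(n+1) - B(n), relating the Pell numbers to the balancing numbers. -/
/-- Relations between Pell numbers and balancing numbers: P(2n) = 2B(n) and
P(2n+1) = B(n+1) − B(n). -/
theorem pell_balancing_relations
    (B : ℕ → ℤ) (hB0 : B 0 = 0) (hB1 : B 1 = 1)
    (hBrec : ∀ k, B (k + 2) = 6 * B (k + 1) - B k)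
    (P : ℕ → ℤ) (hP0 : P 0 = 0) (hP1 : P 1 = 1)
    (hPrec : ∀ k, P (k + 2) = 2 * P (k + 1) + P k) :
    ∀ n : ℕ, P (2 * n) = 2 * B n ∧ P (2 * n + 1) = B (n + 1) - B n := by
  intro n
  induction n with
  | zero => simp [hB0, hB1, hP0, hP1]
  | succ n ih =>
    obtain ⟨h_even, h_odd⟩ := ih
    have h_even_succ : P (2 * (n + 1)) = 2 * B (n + 1) := by
      rw [mul_add_one, hPrec, h_even, h_odd]
      ring
    refine ⟨h_even_succ, ?_⟩
    have h_rec : P (2 * (n + 1) + 1) = 2 * P (2 * (n + 1)) + P (2 * n + 1) := hPrec (2 * n + 1)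
    rw [h_rec, h_even_succ, h_odd, hBrec]
    ring
end

section
/- For every natural number n, c(n)^2 = 8*b(n+1)^2 + 8*b(n+1) + 1; in particular, 8*b(n+1)^2 + 8*b(n+1) + 1 is a perfect square, so b(n+1) is a cobalancing number in the Diophantine sense with Lucas-cobalancing companion c(n). -/
/-- One step of the pair `(b (n + 1), c n)` is affine in the pair itself. -/
theorem cobalancing_step
    (b : ℕ → ℤ) (hb0 : b 0 = 0) (hb1 : b 1 = 0)
    (hbrec : ∀ k, b (k + 2) = 6 * b (k + 1) - b k + 2)
    (c : ℕ → ℤ) (hc0 : c 0 = 1) (hc1 : c 1 = 7)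
    (hcrec : ∀ k, c (k + 2) = 6 * c (k + 1) - c k) (n : ℕ) :
    b (n + 2) = 3 * b (n + 1) + c n + 1 ∧ c (n + 1) = 8 * b (n + 1) + 3 * c n + 4 := by
  induction n with
  | zero =>
    have := hbrec 0
    simp only [zero_add] at this ⊢
    constructor <;> linarith
  | succ n ih =>
    obtain ⟨hb, hc⟩ := ih
    have hb' := hbrec (n + 1)
    have hc' := hcrec n
    constructor <;> linarith


/-- c(n)² = 8·b(n+1)² + 8·b(n+1) + 1: every b(n+1) is a cobalancing number in the
Diophantine sense, with Lucas-cobalancing companion c(n). -/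
theorem lucas_cobalancing_sq
    (b : ℕ → ℤ) (hb0 : b 0 = 0) (hb1 : b 1 = 0)
    (hbrec : ∀ k, b (k + 2) = 6 * b (k + 1) - b k + 2)
    (c : ℕ → ℤ) (hc0 : c 0 = 1) (hc1 : c 1 = 7)
    (hcrec : ∀ k, c (k + 2) = 6 * c (k + 1) - c k) :
    ∀ n : ℕ, c n ^ 2 = 8 * b (n + 1) ^ 2 + 8 * b (n + 1) + 1 ∧
      ∃ m : ℤ, m ^ 2 = 8 * b (n + 1) ^ 2 + 8 * b (n + 1) + 1 := by
  intro n
  have key : c n ^ 2 = 8 * b (n + 1) ^ 2 + 8 * b (n + 1) + 1 := by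
    induction n with
    | zero => simp [hc0, hb1]
    | succ n ih =>
      obtain ⟨hb, hc⟩ := cobalancing_step b hb0 hb1 hbrec c hc0 hc1 hcrec n
      rw [hb, hc]
      linear_combination ih
  exact ⟨key, c n, key⟩
end
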